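/- In any group there is a unique largest normal locally virtually-polycyclic subgroup, and this subgroup is characteristic (invariant under all automorphisms of the group). -/

import Mathlib

universe u v

/-- A group is polycyclic if it has a subnormal series with cyclic factors; equivalently
(peeling off the top factor of the series), it is trivial or has a polycyclic normal
subgroup with cyclic quotient. -/
inductive IsPolycyclic : ∀ (G : Type u) [Group G], Prop
  | of_subsingleton (G : Type u) [Group G] (h : Subsingleton G) : IsPolycyclic G
  | step (G : Type u) [Group G] (N : Subgroup G) (hN : N.Normal)
      (h1 : IsPolycyclic N) (h2 : IsCyclic (G ⧸ N)) : IsPolycyclic G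

/-- A group is virtually polycyclic if it has a polycyclic subgroup of finite index. -/
def IsVirtuallyPolycyclic (G : Type u) [Group G] : Prop :=
  ∃ H : Subgroup G, H.FiniteIndex ∧ IsPolycyclic H

theorem IsPolycyclic.of_injective {Q : Type u} [Group Q] (h : IsPolycyclic Q) :
    ∀ (G : Type u) [Group G] (f : G →* Q), Function.Injective f → IsPolycyclic G := by
  induction h with
  | of_subsingleton Q hQ =>
    intro G _ f hf
    exact .of_subsingleton G hf.subsingleton
  | step Q N hN h1 h2 ih =>
    intro G _ f hf
    refine .step G (N.comap f) inferInstance ?_ ?_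
    · refine ih _ (f.subgroupComap N) ?_
      intro a b hab
      apply Subtype.ext
      apply hf
      exact congrArg Subtype.val hab
    · refine isCyclic_of_injective (QuotientGroup.map (N.comap f) N f le_rfl) ?_
      rw [← MonoidHom.ker_eq_bot_iff, QuotientGroup.ker_map]
      simp

theorem IsPolycyclic.of_surjective {G : Type u} [Group G] (h : IsPolycyclic G) :
    ∀ (Q : Type u) [Group Q] (f : G →* Q), Function.Surjective f → IsPolycyclic Q := by
  induction h with
  | of_subsingleton G hG =>
    intro Q _ f hf
    exact .of_subsingleton Q hf.subsingleton
  | step G N hN h1 h2 ih =>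
    intro Q _ f hf
    have hn : (N.map f).Normal := hN.map f hf
    refine .step Q (N.map f) hn ?_ ?_
    · exact ih _ (f.subgroupMap N) (f.subgroupMap_surjective N)
    · refine isCyclic_of_surjective
        (QuotientGroup.map N (N.map f) f (Subgroup.le_comap_map f N)) ?_
      intro q
      obtain ⟨q, rfl⟩ := QuotientGroup.mk_surjective q
      obtain ⟨g, rfl⟩ := hf q
      exact ⟨(g : G ⧸ N), rfl⟩

theorem IsPolycyclic.of_hom_cyclic {G : Type u} [Group G] {Q : Type*} [Group Q] [IsCyclic Q]
    (f : G →* Q) (h : IsPolycyclic f.ker) : IsPolycyclic G :=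
  .step G f.ker inferInstance h
    (isCyclic_of_injective (QuotientGroup.kerLift f) (QuotientGroup.kerLift_injective f))

theorem IsPolycyclic.fg {G : Type u} [Group G] (h : IsPolycyclic G) : Group.FG G := by
  induction h with
  | of_subsingleton G hG => infer_instance
  | step G N hN h1 h2 ih =>
    obtain ⟨t, ht⟩ := h2.exists_generator
    obtain ⟨t, rfl⟩ := QuotientGroup.mk_surjective t
    have hN' : N.FG := (Group.fg_iff_subgroup_fg N).1 ih
    have : (N ⊔ Subgroup.closure {t}).FG := hN'.sup ⟨{t}, by simp⟩
    rw [Group.fg_def]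
    convert this
    symm
    rw [eq_top_iff]
    intro g _
    obtain ⟨k, hk⟩ := Subgroup.mem_zpowers_iff.1 (ht (g : G ⧸ N))
    rw [← QuotientGroup.mk_zpow, QuotientGroup.eq] at hk
    have : g = t ^ k * ((t ^ k)⁻¹ * g) := by group
    rw [this]
    have h3 : t ∈ N ⊔ Subgroup.closure {t} :=
      Subgroup.mem_sup_right (Subgroup.subset_closure (Set.mem_singleton t))
    exact Subgroup.mul_mem _ (Subgroup.zpow_mem _ h3 k) (Subgroup.mem_sup_left hk)

theorem IsVirtuallyPolycyclic.fg {G : Type u} [Group G] (h : IsVirtuallyPolycyclic G) :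
    Group.FG G := by
  obtain ⟨H, hfi, hp⟩ := h
  have hH : H.FG := (Group.fg_iff_subgroup_fg H).1 hp.fg
  have hfin : (Set.range (Quotient.out : G ⧸ H → G)).Finite :=
    @Set.finite_range _ _ _ (inferInstanceAs (Finite (G ⧸ H)))
  have : (H ⊔ Subgroup.closure (Set.range (Quotient.out : G ⧸ H → G))).FG :=
    hH.sup ((Subgroup.fg_iff _).2 ⟨_, rfl, hfin⟩)
  rw [Group.fg_def]
  convert this
  symm
  rw [eq_top_iff]
  intro g _
  have h1 : ((Quotient.out (g : G ⧸ H) : G) : G ⧸ H) = g := Quotient.out_eq _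
  rw [QuotientGroup.eq] at h1
  have : g = (Quotient.out (g : G ⧸ H) : G) * ((Quotient.out (g : G ⧸ H) : G)⁻¹ * g) := by group
  rw [this]
  exact mul_mem (Subgroup.mem_sup_right (Subgroup.subset_closure ⟨_, rfl⟩))
    (Subgroup.mem_sup_left h1)

theorem IsVirtuallyPolycyclic.of_injective {G Q : Type u} [Group G] [Group Q]
    (h : IsVirtuallyPolycyclic Q) (f : G →* Q) (hf : Function.Injective f) :
    IsVirtuallyPolycyclic G := by
  obtain ⟨H, hfi, hp⟩ := h
  refine ⟨H.comap f, ?_, ?_⟩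
  · rw [Subgroup.finiteIndex_iff, Subgroup.index_comap]
    have := Subgroup.isFiniteRelIndex_of_finiteIndex (H := H) (K := f.range)
    exact this.relIndex_ne_zero
  · refine hp.of_injective _ (f.subgroupComap H) ?_
    intro a b hab
    apply Subtype.ext
    apply hf
    exact congrArg Subtype.val hab

theorem IsVirtuallyPolycyclic.of_surjective {G Q : Type u} [Group G] [Group Q]
    (h : IsVirtuallyPolycyclic G) (f : G →* Q) (hf : Function.Surjective f) :
    IsVirtuallyPolycyclic Q := by
  obtain ⟨H, hfi, hp⟩ := h
  refine ⟨H.map f, ?_, hp.of_surjective _ (f.subgroupMap H) (f.subgroupMap_surjective H)⟩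
  rw [Subgroup.finiteIndex_iff]
  exact ne_zero_of_dvd_ne_zero hfi.index_ne_zero (Subgroup.index_map_dvd H hf)

theorem IsVirtuallyPolycyclic.of_finiteIndex {G : Type u} [Group G] (H : Subgroup G)
    [H.FiniteIndex] (h : IsVirtuallyPolycyclic H) : IsVirtuallyPolycyclic G := by
  obtain ⟨K, hK, hp⟩ := h
  refine ⟨K.map H.subtype, ?_, hp.of_surjective _ (H.subtype.subgroupMap K)
    (H.subtype.subgroupMap_surjective K)⟩
  rw [Subgroup.finiteIndex_iff, Subgroup.index_map_subtype]
  exact mul_ne_zero hK.index_ne_zero Subgroup.FiniteIndex.index_ne_zero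

theorem finite_hom_of_fg (G M : Type*) [Group G] [Group M] [Group.FG G] [Finite M] :
    Finite (G →* M) := by
  obtain ⟨S, hS, hfin⟩ := Group.fg_iff.1 (inferInstance : Group.FG G)
  have := hfin.to_subtype
  refine Finite.of_injective (β := S → M) (fun f s => f s) ?_
  intro f g hfg
  exact MonoidHom.eq_of_eqOn_dense hS fun s hs => congrFun hfg ⟨s, hs⟩

theorem exists_char_le {G : Type*} [Group G] [Group.FG G] (P : Subgroup G) [P.FiniteIndex] :
    ∃ C : Subgroup G, C.Characteristic ∧ C.FiniteIndex ∧ C ≤ P := by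
  have := finite_hom_of_fg G (Equiv.Perm (G ⧸ P))
  refine ⟨⨅ f : G →* Equiv.Perm (G ⧸ P), f.ker, ?_, ?_, ?_⟩
  · rw [Subgroup.characteristic_iff_le_comap]
    intro φ x hx
    rw [Subgroup.mem_comap, Subgroup.mem_iInf]
    rw [Subgroup.mem_iInf] at hx
    intro f
    exact hx (f.comp φ.toMonoidHom)
  · exact Subgroup.finiteIndex_iInf fun f => inferInstance
  · refine (iInf_le _ (MulAction.toPermHom G (G ⧸ P))).trans ?_
    rw [← Subgroup.normalCore_eq_ker]
    exact P.normalCore_le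

theorem IsVirtuallyPolycyclic.step {G : Type u} [Group G] (N : Subgroup G) [hN : N.Normal]
    (h : IsVirtuallyPolycyclic N) (hc : IsCyclic (G ⧸ N)) : IsVirtuallyPolycyclic G := by
  have hfg := h.fg
  obtain ⟨P, hP, hp⟩ := h
  obtain ⟨C, hchar, hCfi, hCP⟩ := exists_char_le P
  have hC : IsPolycyclic C :=
    hp.of_injective _ (Subgroup.inclusion hCP) (Subgroup.inclusion_injective hCP)
  let L : Subgroup G := C.map N.subtype
  have hLN : L.Normal := inferInstance
  have hL : IsPolycyclic L := hC.of_surjective _ (N.subtype.subgroupMap C)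
    (N.subtype.subgroupMap_surjective C)
  obtain ⟨t, ht⟩ := hc.exists_generator
  obtain ⟨t, rfl⟩ := QuotientGroup.mk_surjective t
  let T : Subgroup (G ⧸ L) := Subgroup.zpowers (t : G ⧸ L)
  let R : Subgroup G := T.comap (QuotientGroup.mk' L)
  refine ⟨R, ?_, ?_⟩
  · rw [Subgroup.finiteIndex_iff_finite_quotient]
    have hLR : L ≤ R := by
      intro x hx
      have : (x : G ⧸ L) = 1 := (QuotientGroup.eq_one_iff x).2 hx
      change (x : G ⧸ L) ∈ T
      rw [this]; exact one_mem _
    have htR : t ∈ R := Subgroup.mem_zpowers (t : G ⧸ L)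
    refine Finite.of_surjective (α := N ⧸ C)
      (Quotient.lift (fun n : N => ((n : G) : G ⧸ R)) ?_) ?_
    · intro a b hab
      have hab' := QuotientGroup.leftRel_apply.1 hab
      rw [QuotientGroup.eq]
      exact hLR ⟨_, hab', by simp⟩
    · intro q
      obtain ⟨g, rfl⟩ := QuotientGroup.mk_surjective q
      obtain ⟨k, hk⟩ := Subgroup.mem_zpowers_iff.1 (ht (g : G ⧸ N))
      rw [← QuotientGroup.mk_zpow, QuotientGroup.eq] at hk
      have hk2 := hN.mem_comm hk
      refine ⟨((⟨_, hk2⟩ : N) : N ⧸ C), ?_⟩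
      change ((g * (t ^ k)⁻¹ : G) : G ⧸ R) = (g : G ⧸ R)
      rw [QuotientGroup.eq]
      have : (g * (t ^ k)⁻¹)⁻¹ * g = t ^ k := by group
      rw [this]
      exact zpow_mem htR k
  · refine IsPolycyclic.of_hom_cyclic ((QuotientGroup.mk' L).subgroupComap T) ?_
    have hmem : ∀ x : ((QuotientGroup.mk' L).subgroupComap T).ker, ((x : R) : G) ∈ L := by
      intro x
      have := congrArg Subtype.val (MonoidHom.mem_ker.1 x.2)
      exact (QuotientGroup.eq_one_iff _).1 this
    refine hL.of_injective _ ((R.subtype.comp (Subgroup.subtype _)).codRestrict L hmem) ?_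
    intro a b hab
    have h := congrArg Subtype.val hab
    exact Subtype.ext (Subtype.ext h)

theorem IsVirtuallyPolycyclic.ext_aux {Q : Type u} [Group Q] (h : IsPolycyclic Q) :
    ∀ (G : Type u) [Group G] (f : G →* Q), IsVirtuallyPolycyclic f.ker →
      IsVirtuallyPolycyclic G := by
  induction h with
  | of_subsingleton Q hQ =>
    intro G _ f hf
    exact hf.of_injective ((MonoidHom.id G).codRestrict f.ker
      fun x => Subsingleton.elim _ _) fun a b hab => congrArg Subtype.val hab
  | step Q N hN h1 h2 ih =>
    intro G _ f hf
    have hv : IsVirtuallyPolycyclic (N.comap f) := by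
      refine ih _ (f.subgroupComap N) ?_
      have hmem : ∀ x : (f.subgroupComap N).ker, ((x : N.comap f) : G) ∈ f.ker := by
        intro x
        exact congrArg Subtype.val (MonoidHom.mem_ker.1 x.2)
      refine hf.of_injective
        (((N.comap f).subtype.comp (Subgroup.subtype _)).codRestrict f.ker hmem) ?_
      intro a b hab
      have h := congrArg Subtype.val hab
      exact Subtype.ext (Subtype.ext h)
    refine hv.step _ ?_
    refine isCyclic_of_injective (QuotientGroup.map (N.comap f) N f le_rfl) ?_
    rw [← MonoidHom.ker_eq_bot_iff, QuotientGroup.ker_map]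
    simp

theorem IsVirtuallyPolycyclic.ext_hom {G Q : Type u} [Group Q] [Group G]
    (h : IsVirtuallyPolycyclic Q) (f : G →* Q) (hf : IsVirtuallyPolycyclic f.ker) :
    IsVirtuallyPolycyclic G := by
  obtain ⟨H, hfi, hp⟩ := h
  have : (H.comap f).FiniteIndex := by
    rw [Subgroup.finiteIndex_iff, Subgroup.index_comap]
    have := Subgroup.isFiniteRelIndex_of_finiteIndex (H := H) (K := f.range)
    exact this.relIndex_ne_zero
  refine .of_finiteIndex (H.comap f) ?_
  refine IsVirtuallyPolycyclic.ext_aux hp _ (f.subgroupComap H) ?_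
  have hmem : ∀ x : (f.subgroupComap H).ker, ((x : H.comap f) : G) ∈ f.ker := by
    intro x
    exact congrArg Subtype.val (MonoidHom.mem_ker.1 x.2)
  refine hf.of_injective
    (((H.comap f).subtype.comp (Subgroup.subtype _)).codRestrict f.ker hmem) ?_
  intro a b hab
  have h := congrArg Subtype.val hab
  exact Subtype.ext (Subtype.ext h)

/-- Locally virtually polycyclic subgroup, phrased inside the ambient group. -/
def LVP {G : Type u} [Group G] (H : Subgroup G) : Prop :=
  ∀ F : Subgroup G, F ≤ H → F.FG → IsVirtuallyPolycyclic F

theorem lvp_iff {G : Type u} [Group G] (H : Subgroup G) :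
    (∀ F : Subgroup H, Group.FG F → IsVirtuallyPolycyclic F) ↔ LVP H := by
  constructor
  · intro h F hF hfg
    have h1 : Group.FG F := (Group.fg_iff_subgroup_fg F).2 hfg
    let e := Subgroup.subgroupOfEquivOfLe hF
    have h2 : Group.FG (F.subgroupOf H) := Group.fg_of_surjective (f := e.symm.toMonoidHom) e.symm.surjective
    exact (h _ h2).of_surjective e.toMonoidHom e.surjective
  · intro h F hF
    have h1 : Group.FG (F.map H.subtype) :=
      Group.fg_of_surjective (f := H.subtype.subgroupMap F) (H.subtype.subgroupMap_surjective F)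
    refine (h (F.map H.subtype) (Subgroup.map_subtype_le F)
      ((Group.fg_iff_subgroup_fg _).1 h1)).of_injective (H.subtype.subgroupMap F) ?_
    intro a b hab
    have h := congrArg Subtype.val hab
    exact Subtype.ext (Subtype.ext h)

theorem IsVirtuallyPolycyclic.mono {G : Type u} [Group G] {H K : Subgroup G}
    (h : IsVirtuallyPolycyclic K) (hHK : H ≤ K) : IsVirtuallyPolycyclic H :=
  h.of_injective (Subgroup.inclusion hHK) (Subgroup.inclusion_injective hHK)

theorem IsVirtuallyPolycyclic.sup {G : Type u} [Group G] {X W : Subgroup G}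
    (hX : IsVirtuallyPolycyclic X) (hW : IsVirtuallyPolycyclic W)
    (hn : X ≤ Subgroup.normalizer (W : Set G)) : IsVirtuallyPolycyclic (X ⊔ W : Subgroup G) := by
  have hnorm : (W.subgroupOf (X ⊔ W)).Normal :=
    Subgroup.normal_subgroupOf_of_le_normalizer (sup_le hn Subgroup.le_normalizer)
  let f := QuotientGroup.mk' (W.subgroupOf (X ⊔ W))
  refine IsVirtuallyPolycyclic.ext_hom ?_ f ?_
  · refine hX.of_surjective (f.comp (Subgroup.inclusion le_sup_left)) ?_
    intro q
    obtain ⟨⟨g, hg⟩, rfl⟩ := QuotientGroup.mk_surjective q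
    have hg2 := hg
    rw [← SetLike.mem_coe, Subgroup.coe_mul_of_left_le_normalizer_right _ _ hn] at hg2
    obtain ⟨x, hx, w, hw, rfl⟩ := hg2
    refine ⟨⟨x, hx⟩, ?_⟩
    refine QuotientGroup.eq.2 ?_
    rw [Subgroup.mem_subgroupOf]
    simpa using hw
  · rw [QuotientGroup.ker_mk']
    let e := Subgroup.subgroupOfEquivOfLe (le_sup_right : W ≤ X ⊔ W)
    exact hW.of_injective e.toMonoidHom e.injective

theorem conj_mem_of_closure {G : Type*} [Group G] {A : Set G} (hA : ∀ a ∈ A, a⁻¹ ∈ A)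
    {W : Subgroup G} (h : ∀ a ∈ A, ∀ w ∈ W, a * w * a⁻¹ ∈ W) :
    Subgroup.closure A ≤ Subgroup.normalizer (W : Set G) := by
  rw [Subgroup.closure_le]
  intro a ha
  rw [SetLike.mem_coe, Subgroup.mem_normalizer_iff]
  intro w
  refine ⟨h a ha w, fun hw => ?_⟩
  have := h _ (hA a ha) _ hw
  simpa [mul_assoc] using this

theorem LVP.sup_aux {G : Type u} [Group G] {H K : Subgroup G} [H.Normal] [K.Normal]
    (hH : LVP H) (hK : LVP K) (A B : Set G) (hAf : A.Finite) (hBf : B.Finite)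
    (hA : A ⊆ H) (hB : B ⊆ K) (hinv : ∀ a ∈ A, a⁻¹ ∈ A) :
    ∃ Z : Subgroup G, A ⊆ Z ∧ B ⊆ Z ∧ IsVirtuallyPolycyclic Z := by
  let X := Subgroup.closure A
  let C : Set G := Set.image2 (fun a b => (a * b * a⁻¹ * b⁻¹)) A B
  have hCf : C.Finite := hAf.image2 _ hBf
  have hCH : C ⊆ H := by
    rintro _ ⟨a, ha, b, hb, rfl⟩
    have h1 : b * a⁻¹ * b⁻¹ ∈ H := Subgroup.Normal.conj_mem inferInstance _ (inv_mem (hA ha)) b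
    have : (a * b * a⁻¹ * b⁻¹) = a * (b * a⁻¹ * b⁻¹) := by group
    change (a * b * a⁻¹ * b⁻¹) ∈ H
    rw [this]
    exact mul_mem (hA ha) h1
  have hCK : C ⊆ K := by
    rintro _ ⟨a, ha, b, hb, rfl⟩
    have h1 : a * b * a⁻¹ ∈ K := Subgroup.Normal.conj_mem inferInstance _ (hB hb) a
    exact mul_mem h1 (inv_mem (hB hb))
  have hXE : X ≤ Subgroup.closure (A ∪ C) := Subgroup.closure_mono Set.subset_union_left
  have hEH : Subgroup.closure (A ∪ C) ≤ H := (Subgroup.closure_le _).2 (Set.union_subset hA hCH)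
  have hE : IsVirtuallyPolycyclic (Subgroup.closure (A ∪ C)) :=
    hH _ hEH ((Subgroup.fg_iff _).2 ⟨_, rfl, hAf.union hCf⟩)
  let S : Set G := {g | ∃ x ∈ X, ∃ c ∈ C, g = x * c * x⁻¹}
  let D := Subgroup.closure S
  have hCD : C ⊆ D := fun c hc => Subgroup.subset_closure ⟨1, one_mem _, c, hc, by simp⟩
  have hDE : D ≤ Subgroup.closure (A ∪ C) := by
    refine (Subgroup.closure_le _).2 ?_
    rintro _ ⟨x, hx, c, hc, rfl⟩
    exact mul_mem (mul_mem (hXE hx) (Subgroup.subset_closure (Or.inr hc))) (inv_mem (hXE hx))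
  have hDK : D ≤ K := by
    refine (Subgroup.closure_le _).2 ?_
    rintro _ ⟨x, hx, c, hc, rfl⟩
    exact Subgroup.Normal.conj_mem inferInstance _ (hCK hc) x
  have hD : D.FG := (Group.fg_iff_subgroup_fg D).1 (hE.mono hDE).fg
  have hXD : X ≤ Subgroup.normalizer (D : Set G) := by
    rw [Subgroup.le_normalizer_closure_iff]
    rintro h hh _ ⟨x, hx, c, hc, rfl⟩
    exact Subgroup.subset_closure ⟨h * x, mul_mem hh hx, c, hc, by group⟩
  let W := Subgroup.closure B ⊔ D
  have hW : IsVirtuallyPolycyclic W :=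
    hK _ (sup_le ((Subgroup.closure_le _).2 hB) hDK)
      (Subgroup.FG.sup ((Subgroup.fg_iff _).2 ⟨_, rfl, hBf⟩) hD)
  have hXW : X ≤ Subgroup.normalizer (W : Set G) := by
    refine conj_mem_of_closure hinv ?_
    intro a ha
    change W ≤ W.comap (MulAut.conj a).toMonoidHom
    refine sup_le ((Subgroup.closure_le _).2 ?_) ?_
    · intro b hb
      change a * b * a⁻¹ ∈ W
      have : a * b * a⁻¹ = (a * b * a⁻¹ * b⁻¹) * b := by group
      rw [this]
      exact mul_mem (Subgroup.mem_sup_right (hCD ⟨a, ha, b, hb, rfl⟩))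
        (Subgroup.mem_sup_left (Subgroup.subset_closure hb))
    · intro d hd
      exact Subgroup.mem_sup_right
        ((Subgroup.mem_normalizer_iff.1 (hXD (Subgroup.subset_closure ha)) d).1 hd)
  refine ⟨X ⊔ W, ?_, ?_, (hE.mono hXE).sup hW hXW⟩
  · exact fun a ha => Subgroup.mem_sup_left (Subgroup.subset_closure ha)
  · exact fun b hb => Subgroup.mem_sup_right (Subgroup.mem_sup_left (Subgroup.subset_closure hb))

theorem LVP.sup {G : Type u} [Group G] {H K : Subgroup G} [hHn : H.Normal] [hKn : K.Normal]
    (hH : LVP H) (hK : LVP K) : LVP (H ⊔ K) := by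
  intro F hF hfg
  obtain ⟨S, hS, hSf⟩ := (Subgroup.fg_iff _).1 hfg
  have hdec : ∀ s : G, ∃ h k, s ∈ S → h ∈ H ∧ k ∈ K ∧ h * k = s := by
    intro s
    by_cases hs : s ∈ S
    · have : s ∈ H ⊔ K := hF (hS ▸ Subgroup.subset_closure hs)
      obtain ⟨h, hh, k, hk, e⟩ := Subgroup.mem_sup_of_normal_right.1 this
      exact ⟨h, k, fun _ => ⟨hh, hk, e⟩⟩
    · exact ⟨1, 1, fun h => absurd h hs⟩
  choose a b hab using hdec
  obtain ⟨Z, hAZ, hBZ, hZ⟩ := LVP.sup_aux hH hK (a '' S ∪ (fun s => (a s)⁻¹) '' S) (b '' S)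
    ((hSf.image _).union (hSf.image _)) (hSf.image _)
    (by
      rintro _ (⟨s, hs, rfl⟩ | ⟨s, hs, rfl⟩)
      · exact (hab s hs).1
      · exact inv_mem (hab s hs).1)
    (by
      rintro _ ⟨s, hs, rfl⟩
      exact (hab s hs).2.1)
    (by
      rintro _ (⟨s, hs, rfl⟩ | ⟨s, hs, rfl⟩)
      · exact Or.inr ⟨s, hs, rfl⟩
      · exact Or.inl ⟨s, hs, by simp⟩)
  refine hZ.mono ?_
  rw [← hS, Subgroup.closure_le]
  intro s hs
  rw [← (hab s hs).2.2]
  exact mul_mem (hAZ (Or.inl ⟨s, hs, rfl⟩)) (hBZ ⟨s, hs, rfl⟩)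

theorem LVP.sSup {G : Type u} [Group G] :
    LVP (sSup {M : Subgroup G | M.Normal ∧ LVP M}) := by
  intro F hF hfg
  obtain ⟨S, hS, hSf⟩ := (Subgroup.fg_iff _).1 hfg
  have hne : {M : Subgroup G | M.Normal ∧ LVP M}.Nonempty := by
    refine ⟨⊥, inferInstance, ?_⟩
    intro F hF _
    obtain rfl := le_bot_iff.1 hF
    exact ⟨⊤, inferInstance, .of_subsingleton _ inferInstance⟩
  have hdir : DirectedOn (· ≤ ·) {M : Subgroup G | M.Normal ∧ LVP M} := by
    rintro H ⟨hHn, hH⟩ K ⟨hKn, hK⟩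
    exact ⟨H ⊔ K, ⟨inferInstance, hH.sup hK⟩, le_sup_left, le_sup_right⟩
  have hkey : ∃ M : Subgroup G, (M.Normal ∧ LVP M) ∧ S ⊆ M := by
    have hSs : S ⊆ (SupSet.sSup {M : Subgroup G | M.Normal ∧ LVP M} : Subgroup G) :=
      fun s hs => hF (hS ▸ Subgroup.subset_closure hs)
    clear hS
    induction S, hSf using Set.Finite.induction_on with
    | empty => exact ⟨hne.some, hne.some_mem, Set.empty_subset _⟩
    | @insert s S _ _ ih =>
      obtain ⟨M, hM, hSM⟩ := ih fun x hx => hSs (Or.inr hx)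
      obtain ⟨M', hM', hs⟩ := (Subgroup.mem_sSup_of_directedOn hne hdir).1 (hSs (Or.inl rfl))
      obtain ⟨L, hL, h1, h2⟩ := hdir M hM M' hM'
      exact ⟨L, hL, Set.insert_subset (h2 hs) fun x hx => h1 (hSM hx)⟩
  obtain ⟨M, hM, hSM⟩ := hkey
  exact hM.2 F (hS ▸ (Subgroup.closure_le _).2 hSM) hfg

theorem LVP.map {G : Type u} [Group G] {H : Subgroup G} (hH : LVP H) (φ : G ≃* G) :
    LVP (H.map φ.toMonoidHom) := by
  intro F hF hfg
  have h1 : F.map φ.symm.toMonoidHom ≤ H := by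
    rintro _ ⟨x, hx, rfl⟩
    obtain ⟨y, hy, rfl⟩ := hF hx
    simpa using hy
  have hfg' : Group.FG F := (Group.fg_iff_subgroup_fg F).2 hfg
  have h2 : Group.FG (F.map φ.symm.toMonoidHom) :=
    Group.fg_of_surjective (f := φ.symm.toMonoidHom.subgroupMap F)
      (φ.symm.toMonoidHom.subgroupMap_surjective F)
  refine (hH _ h1 ((Group.fg_iff_subgroup_fg _).1 h2)).of_injective
    (φ.symm.toMonoidHom.subgroupMap F) ?_
  intro a b hab
  exact Subtype.ext (φ.symm.injective (congrArg Subtype.val hab))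

/-- In any group there is a unique largest normal locally virtually-polycyclic subgroup, and
this subgroup is characteristic. -/
theorem exists_unique_largest_normal_locallyVirtuallyPolycyclic (G : Type u) [Group G] :
    ∃! N : Subgroup G,
      N.Normal ∧ (∀ F : Subgroup N, Group.FG F → IsVirtuallyPolycyclic F) ∧
        (∀ M : Subgroup G, M.Normal →
          (∀ F : Subgroup M, Group.FG F → IsVirtuallyPolycyclic F) → M ≤ N) ∧
        N.Characteristic := by
  simp only [lvp_iff]
  have hmax : ∀ M : Subgroup G, M.Normal → LVP M →
      M ≤ sSup {M : Subgroup G | M.Normal ∧ LVP M} := fun M h1 h2 => le_sSup ⟨h1, h2⟩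
  have hchar : (sSup {M : Subgroup G | M.Normal ∧ LVP M}).Characteristic := by
    rw [Subgroup.characteristic_iff_map_le]
    intro φ
    rw [Subgroup.map_le_iff_le_comap]
    refine sSup_le ?_
    rintro M ⟨hn, hM⟩
    rw [← Subgroup.map_le_iff_le_comap]
    exact hmax _ (hn.map _ φ.surjective) (hM.map φ)
  refine ⟨sSup {M : Subgroup G | M.Normal ∧ LVP M},
    ⟨inferInstance, LVP.sSup, hmax, hchar⟩, ?_⟩
  rintro N ⟨h1, h2, h3, h4⟩
  exact le_antisymm (hmax N h1 h2) (h3 _ inferInstance LVP.sSup)
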